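/- If r ≥ 1 and η = rβ − 3/2 > 0, then the function G₁(x, θ) = (1/2)∑_{i=1}^K ([Rx]_i)²/θ_i + ∑_{i=1}^K (θ_i/ϑ_i)^r − η ∑_{i=1}^K log θ_i is convex on ℝ^N × ℝ_{++}^K; in particular, for every (x, θ) in this region, every u ∈ ℝ^N and every v ∈ ℝ^K, the Hessian quadratic form satisfies (u, v)ᵀ H_{G₁}(x, θ) (u, v) = ∑_{i=1}^K θ_i^{-1} ([Ru]_i − θ_i^{-1} v_i [Rx]_i)² + ∑_{i=1}^K v_i² (η θ_i^{-2} + (r(r−1)/ϑ_i^r) θ_i^{r−2}) ≥ 0. -/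

import Mathlib

open Real

/-- `G₁(x, θ) = (1/2)∑ᵢ ([Rx]ᵢ)²/θᵢ + ∑ᵢ (θᵢ/ϑᵢ)^r − η ∑ᵢ log θᵢ`. -/
noncomputable def gibbsG1 (N K : ℕ) (R : Matrix (Fin K) (Fin N) ℝ)
    (r η : ℝ) (vth : Fin K → ℝ) : (Fin N → ℝ) × (Fin K → ℝ) → ℝ :=
  fun p =>
    (1 / 2) * ∑ i, (R.mulVec p.1 i) ^ 2 / p.2 i
      + ∑ i, (p.2 i / vth i) ^ r
      - η * ∑ i, Real.log (p.2 i)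

open Filter Topology

theorem ConvexOn.finset_sum {ι E : Type*} [AddCommGroup E] [Module ℝ E] {s : Set E}
    (hs : Convex ℝ s) {f : ι → E → ℝ} (t : Finset ι) (hf : ∀ i ∈ t, ConvexOn ℝ s (f i)) :
    ConvexOn ℝ s fun x => ∑ i ∈ t, f i x := by
  classical
  induction t using Finset.induction_on with
  | empty => simpa using convexOn_const (0 : ℝ) hs
  | insert a t ha ih =>
    simp only [Finset.sum_insert ha]
    exact (hf a (by simp)).add (ih fun i hi => hf i (by simp [hi]))

theorem convexOn_sq_div : ConvexOn ℝ {p : ℝ × ℝ | 0 < p.2} fun p => p.1 ^ 2 / p.2 := by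
  refine ⟨convex_halfSpace_gt (LinearMap.snd ℝ ℝ ℝ).isLinear 0, ?_⟩
  rintro ⟨x, s⟩ hs ⟨y, t⟩ ht a b ha hb hab
  simp only [Set.mem_ofPred_eq, Prod.smul_mk, Prod.mk_add_mk, smul_eq_mul] at *
  have hpos : 0 < a * s + b * t := by
    rcases ha.eq_or_lt with rfl | ha
    · obtain rfl : b = 1 := by linarith
      linarith
    · positivity
  rw [div_le_iff₀ hpos, ← sub_nonneg]
  have : (a * (x ^ 2 / s) + b * (y ^ 2 / t)) * (a * s + b * t) - (a * x + b * y) ^ 2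
      = a * b * (x * t - y * s) ^ 2 / (s * t) := by
    field_simp
    ring
  rw [this]
  positivity

/-- The Hessian quadratic form is the second derivative along the corresponding line. -/
theorem ContDiffAt.iteratedFDeriv_two_eq_of_hasDerivAt {E : Type*} [NormedAddCommGroup E]
    [NormedSpace ℝ E] {f : E → ℝ} {p w : E} {g : ℝ → ℝ} {d : ℝ} (hf : ContDiffAt ℝ 2 f p)
    (hg : ∀ᶠ s in 𝓝 (0 : ℝ), HasDerivAt (fun s : ℝ => f (p + s • w)) (g s) s)
    (hd : HasDerivAt g d 0) : iteratedFDeriv ℝ 2 f p ![w, w] = d := by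
  have hline : ∀ s : ℝ, HasDerivAt (fun s : ℝ => p + s • w) w s := fun s => by
    simpa using ((hasDerivAt_id s).smul_const w).const_add p
  have hlim : Tendsto (fun s : ℝ => p + s • w) (𝓝 0) (𝓝 p) := by
    simpa using (hline 0).continuousAt.tendsto
  have heq : (fun s : ℝ => fderiv ℝ f (p + s • w) w) =ᶠ[𝓝 0] g := by
    filter_upwards [hg, hlim.eventually (hf.eventually (by simp))] with s hs hfs
    exact (((hfs.differentiableAt (by simp)).hasFDerivAt).comp_hasDerivAt s (hline s)).unique hs
  have hfd : HasFDerivAt (fderiv ℝ f) (fderiv ℝ (fderiv ℝ f) p) (p + (0 : ℝ) • w) := by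
    have := (hf.fderiv_right (m := 1) (by norm_num)).differentiableAt (by simp)
    simpa using this.hasFDerivAt
  have h1 : HasDerivAt (fun s : ℝ => fderiv ℝ f (p + s • w)) (fderiv ℝ (fderiv ℝ f) p w) 0 :=
    hfd.comp_hasDerivAt (0 : ℝ) (hline 0)
  have h2 : HasDerivAt (fun s : ℝ => fderiv ℝ f (p + s • w) w)
      (fderiv ℝ (fderiv ℝ f) p w w) 0 := by
    simpa using h1.clm_apply (hasDerivAt_const (0 : ℝ) w)
  rw [iteratedFDeriv_two_apply]
  exact h2.unique (hd.congr_of_eventuallyEq heq)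

theorem contDiffAt_gibbsG1 {N K : ℕ} (R : Matrix (Fin K) (Fin N) ℝ) (r η : ℝ)
    {vth : Fin K → ℝ} (hvth : ∀ i, 0 < vth i) (x : Fin N → ℝ) {θ : Fin K → ℝ}
    (hθ : ∀ i, 0 < θ i) : ContDiffAt ℝ 2 (gibbsG1 N K R r η vth) (x, θ) := by
  have h1 : ∀ i, θ i ≠ 0 := fun i => (hθ i).ne'
  have h2 : ∀ i, θ i / vth i ≠ 0 := fun i => (div_pos (hθ i) (hvth i)).ne'
  unfold gibbsG1 Matrix.mulVec dotProduct
  refine ContDiffAt.sub (ContDiffAt.add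
    (contDiffAt_const.mul (ContDiffAt.sum fun i _ => ContDiffAt.div ?_ ?_ (h1 i)))
    (ContDiffAt.sum fun i _ => ContDiffAt.rpow_const_of_ne ?_ (h2 i)))
    (contDiffAt_const.mul (ContDiffAt.sum fun i _ => ContDiffAt.log ?_ (h1 i))) <;> fun_prop

theorem convexOn_gibbsG1 {N K : ℕ} (R : Matrix (Fin K) (Fin N) ℝ) {r η : ℝ}
    {vth : Fin K → ℝ} (hvth : ∀ i, 0 < vth i) (hr : 1 ≤ r) (hη : 0 ≤ η) :
    ConvexOn ℝ {p : (Fin N → ℝ) × (Fin K → ℝ) | ∀ i, 0 < p.2 i} (gibbsG1 N K R r η vth) := by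
  let θ (i : Fin K) : (Fin N → ℝ) × (Fin K → ℝ) →ₗ[ℝ] ℝ :=
    LinearMap.proj i ∘ₗ LinearMap.snd ℝ (Fin N → ℝ) (Fin K → ℝ)
  let q (i : Fin K) : (Fin N → ℝ) × (Fin K → ℝ) →ₗ[ℝ] ℝ :=
    LinearMap.proj i ∘ₗ R.mulVecLin ∘ₗ LinearMap.fst ℝ (Fin N → ℝ) (Fin K → ℝ)
  have hs : Convex ℝ {p : (Fin N → ℝ) × (Fin K → ℝ) | ∀ i, 0 < p.2 i} := by
    simp only [Set.ofPred_forall]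
    exact convex_iInter fun i => convex_halfSpace_gt (θ i).isLinear 0
  have hquad := ConvexOn.finset_sum hs Finset.univ fun i _ =>
    (convexOn_sq_div.comp_linearMap ((q i).prod (θ i))).subset (fun p hp => hp i) hs
  have hpow := ConvexOn.finset_sum hs Finset.univ fun i _ =>
    ((convexOn_rpow hr).comp_linearMap ((vth i)⁻¹ • θ i)).subset
      (fun p hp => mul_nonneg (inv_nonneg.2 (hvth i).le) (hp i).le) hs
  have hlog := ConvexOn.finset_sum hs Finset.univ fun i _ =>
    (strictConcaveOn_log_Ioi.concaveOn.neg.comp_linearMap (θ i)).subset (fun p hp => hp i) hs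
  refine (((hquad.smul (by norm_num : (0 : ℝ) ≤ 1 / 2)).add hpow).add (hlog.smul hη)).congr ?_
  intro p _
  simp [gibbsG1, q, θ, div_eq_inv_mul, sub_eq_add_neg]

section Line

variable {q a t v r η c s : ℝ}

theorem hasDerivAt_gibbsTerm_line (ht : 0 < t + s * v) (hc : 0 < c) :
    HasDerivAt (fun s => 1 / 2 * ((q + s * a) ^ 2 / (t + s * v)) + ((t + s * v) / c) ^ r
        - η * log (t + s * v))
      ((q + s * a) * a / (t + s * v) - 1 / 2 * ((q + s * a) ^ 2 * v / (t + s * v) ^ 2)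
        + v / c * r * ((t + s * v) / c) ^ (r - 1) - η * (v / (t + s * v))) s := by
  have hq : HasDerivAt (fun s => q + s * a) a s := by
    simpa using ((hasDerivAt_id s).mul_const a).const_add q
  have hθ : HasDerivAt (fun s => t + s * v) v s := by
    simpa using ((hasDerivAt_id s).mul_const v).const_add t
  refine HasDerivAt.congr_deriv (((((hq.pow 2).div hθ ht.ne').const_mul (1 / 2)).add
    ((hθ.div_const c).rpow_const (p := r) (Or.inl (div_pos ht hc).ne'))).sub
    ((hθ.log ht.ne').const_mul η)) ?_
  simp only [Pi.pow_apply]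
  field_simp
  ring

theorem hasDerivAt_deriv_gibbsTerm_line (ht : 0 < t) (hc : 0 < c) :
    HasDerivAt (fun s => (q + s * a) * a / (t + s * v)
        - 1 / 2 * ((q + s * a) ^ 2 * v / (t + s * v) ^ 2)
        + v / c * r * ((t + s * v) / c) ^ (r - 1) - η * (v / (t + s * v)))
      (t⁻¹ * (a - t⁻¹ * v * q) ^ 2
        + v ^ 2 * (η / t ^ 2 + (r * (r - 1) / c ^ r) * t ^ (r - 2))) 0 := by
  have hq : HasDerivAt (fun s => q + s * a) a 0 := by
    simpa using ((hasDerivAt_id (0 : ℝ)).mul_const a).const_add q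
  have hθ : HasDerivAt (fun s => t + s * v) v 0 := by
    simpa using ((hasDerivAt_id (0 : ℝ)).mul_const v).const_add t
  have ht0 : t + 0 * v ≠ 0 := by simpa using ht.ne'
  have hpow : (t / c) ^ (r - 1 - 1) = t ^ (r - 2) * c ^ 2 / c ^ r := by
    rw [show r - 1 - 1 = r - 2 by ring, div_rpow ht.le hc.le, rpow_sub hc, rpow_two]
    field_simp
  refine HasDerivAt.congr_deriv (((((hq.mul_const a).div hθ ht0).sub
    ((((hq.pow 2).mul_const v).div (hθ.pow 2) (pow_ne_zero 2 ht0)).const_mul (1 / 2))).add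
    (((hθ.div_const c).rpow_const (p := r - 1)
      (Or.inl (div_ne_zero ht0 hc.ne'))).const_mul (v / c * r))).sub
    (((hasDerivAt_const (0 : ℝ) v).div hθ ht0).const_mul η)) ?_
  simp only [zero_mul, add_zero, hpow, Pi.pow_apply]
  have := (rpow_pos_of_pos hc r).ne'
  field_simp
  ring

end Line

theorem iteratedFDeriv_two_gibbsG1 {N K : ℕ} (R : Matrix (Fin K) (Fin N) ℝ) (r η : ℝ)
    {vth : Fin K → ℝ} (hvth : ∀ i, 0 < vth i) (x : Fin N → ℝ) {θ : Fin K → ℝ}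
    (hθ : ∀ i, 0 < θ i) (u : Fin N → ℝ) (v : Fin K → ℝ) :
    iteratedFDeriv ℝ 2 (gibbsG1 N K R r η vth) (x, θ) ![(u, v), (u, v)] =
      ∑ i, (θ i)⁻¹ * (R.mulVec u i - (θ i)⁻¹ * v i * R.mulVec x i) ^ 2
        + ∑ i, (v i) ^ 2 *
          (η / (θ i) ^ 2 + (r * (r - 1) / (vth i) ^ r) * (θ i) ^ (r - 2)) := by
  rw [← Finset.sum_add_distrib]
  refine (contDiffAt_gibbsG1 R r η hvth x hθ).iteratedFDeriv_two_eq_of_hasDerivAt ?_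
    (HasDerivAt.fun_sum fun i _ => hasDerivAt_deriv_gibbsTerm_line (hθ i) (hvth i))
  have hpos : ∀ᶠ s in 𝓝 (0 : ℝ), ∀ i, 0 < θ i + s * v i := by
    refine eventually_all.2 fun i => ?_
    have hc : ContinuousAt (fun s : ℝ => θ i + s * v i) 0 := by fun_prop
    exact hc.eventually (lt_mem_nhds (by simpa using hθ i))
  filter_upwards [hpos] with s hs
  refine (HasDerivAt.fun_sum fun i _ =>
    hasDerivAt_gibbsTerm_line (hs i) (hvth i)).congr_of_eventuallyEq (.of_forall fun s => ?_)
  simp [gibbsG1, Matrix.mulVec_add, Matrix.mulVec_smul, Finset.sum_add_distrib,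
    Finset.sum_sub_distrib, Finset.mul_sum]

/-- If `r ≥ 1` and `η = rβ − 3/2 > 0`, then `G₁` is convex on `ℝ^N × ℝ_{++}^K`; in
particular, the Hessian quadratic form of `G₁` at any `(x, θ)` with `θ > 0` applied to
`(u, v)` equals
`∑ᵢ θᵢ⁻¹ ([Ru]ᵢ − θᵢ⁻¹ vᵢ [Rx]ᵢ)² + ∑ᵢ vᵢ² (η θᵢ⁻² + (r(r−1)/ϑᵢ^r) θᵢ^{r−2}) ≥ 0`. -/
theorem statement14 (N K : ℕ) (hN : 0 < N) (hK : 0 < K)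
    (R : Matrix (Fin K) (Fin N) ℝ)
    (r β η : ℝ) (hr0 : r ≠ 0) (hβ : 0 < β) (hη_def : η = r * β - 3 / 2)
    (vth : Fin K → ℝ) (hvth : ∀ i, 0 < vth i)
    (hr : 1 ≤ r) (hη : 0 < η) :
    ConvexOn ℝ {p : (Fin N → ℝ) × (Fin K → ℝ) | ∀ i, 0 < p.2 i}
      (gibbsG1 N K R r η vth) ∧
    ∀ (x : Fin N → ℝ) (θ : Fin K → ℝ), (∀ i, 0 < θ i) →
      ∀ (u : Fin N → ℝ) (v : Fin K → ℝ),
        (iteratedFDeriv ℝ 2 (gibbsG1 N K R r η vth) (x, θ) ![(u, v), (u, v)] =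
          ∑ i, (θ i)⁻¹ * (R.mulVec u i - (θ i)⁻¹ * v i * R.mulVec x i) ^ 2
            + ∑ i, (v i) ^ 2 * (η / (θ i) ^ 2 + (r * (r - 1) / (vth i) ^ r) * (θ i) ^ (r - 2))) ∧
        (0 ≤ ∑ i, (θ i)⁻¹ * (R.mulVec u i - (θ i)⁻¹ * v i * R.mulVec x i) ^ 2
            + ∑ i, (v i) ^ 2 * (η / (θ i) ^ 2 + (r * (r - 1) / (vth i) ^ r) * (θ i) ^ (r - 2))) := by
  refine ⟨convexOn_gibbsG1 R hvth hr hη.le, fun x θ hθ u v =>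
    ⟨iteratedFDeriv_two_gibbsG1 R r η hvth x hθ u v, ?_⟩⟩
  refine add_nonneg (Finset.sum_nonneg fun i _ => ?_) (Finset.sum_nonneg fun i _ => ?_)
  · have := hθ i
    positivity
  · have := hθ i
    have := hvth i
    have : 0 ≤ r - 1 := sub_nonneg.2 hr
    positivity
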